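/- Assume the GBDT setup on [a,b] with ξ = a: J = J* = J^{−1} ∈ ℂ^{m×m}; H : [a,b] → ℂ^{m×m} continuous, positive semidefinite; B ∈ ℂ^{n×n} with B − x I_n invertible for x ∈ [a,b]; A(x) = (B − x I_n)^{−1}; Π, S differentiable with Π_x = −i A Π J H, S_x = Π J H J* Π* − (A S + S A*), S(a) = S(a)*, A(a)S(a) − S(a)A(a)* = i Π(a) J Π(a)*, and S(x) invertible on [a,b]. Let W(x,z) and W̃(x,z) be the fundamental solutions, normalized to I_m at x = a, of the initial system w_x = i(z−x)^{−1} J H w and of the transformed system with Hamiltonian H̃ = w_0* H w_0, respectively. If sup_{Im z > 0} ‖W(b,z)‖ < ∞, then sup_{Im z > 0} ‖W̃(b,z)‖ < ∞. The analogous statement holds for the lower half-plane Im z < 0. -/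

import Mathlib

open Matrix
open scoped ComplexOrder

attribute [local instance] Matrix.normedAddCommGroup Matrix.normedSpace

/-- `A(x) = (B − x Iₙ)⁻¹`. -/
noncomputable def Amat {n : ℕ} (B : Matrix (Fin n) (Fin n) ℂ) (x : ℝ) :
    Matrix (Fin n) (Fin n) ℂ :=
  (B - (x : ℂ) • (1 : Matrix (Fin n) (Fin n) ℂ))⁻¹

/-- `w₀(x) = I_m − i J Π(x)* S(x)⁻¹ A(x)⁻¹ Π(x)`. -/
noncomputable def w0fun {m n : ℕ} (J : Matrix (Fin m) (Fin m) ℂ)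
    (B : Matrix (Fin n) (Fin n) ℂ) (S : ℝ → Matrix (Fin n) (Fin n) ℂ)
    (Φ : ℝ → Matrix (Fin n) (Fin m) ℂ) (x : ℝ) : Matrix (Fin m) (Fin m) ℂ :=
  1 - Complex.I • (J * (Φ x)ᴴ * (S x)⁻¹ * (Amat B x)⁻¹ * Φ x)

section Calculus

variable {k l p : ℕ}

theorem Matrix.hasDerivAt_iff_entry {F : ℝ → Matrix (Fin k) (Fin l) ℂ}
    {F' : Matrix (Fin k) (Fin l) ℂ} {x : ℝ} :
    HasDerivAt F F' x ↔ ∀ i j, HasDerivAt (fun t => F t i j) (F' i j) x := by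
  refine (hasDerivAt_pi (φ := fun t i => F t i)).trans ?_
  exact forall_congr' fun i => hasDerivAt_pi (φ := fun t j => F t i j)

theorem HasDerivAt.matrix_mul {F : ℝ → Matrix (Fin k) (Fin l) ℂ}
    {G : ℝ → Matrix (Fin l) (Fin p) ℂ} {F' : Matrix (Fin k) (Fin l) ℂ}
    {G' : Matrix (Fin l) (Fin p) ℂ} {x : ℝ} (hF : HasDerivAt F F' x) (hG : HasDerivAt G G' x) :
    HasDerivAt (fun t => F t * G t) (F' * G x + F x * G') x := by
  rw [Matrix.hasDerivAt_iff_entry] at *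
  intro i j
  simp only [Matrix.mul_apply, Matrix.add_apply, ← Finset.sum_add_distrib]
  exact HasDerivAt.fun_sum fun r _ => (hF i r).mul (hG r j)

theorem HasDerivAt.matrix_conjTranspose {F : ℝ → Matrix (Fin k) (Fin l) ℂ}
    {F' : Matrix (Fin k) (Fin l) ℂ} {x : ℝ} (hF : HasDerivAt F F' x) :
    HasDerivAt (fun t => (F t)ᴴ) F'ᴴ x := by
  rw [Matrix.hasDerivAt_iff_entry] at *
  exact fun i j => (hF j i).star

theorem ContinuousOn.matrix_mul {X : Type*} [TopologicalSpace X] {s : Set X}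
    {F : X → Matrix (Fin k) (Fin l) ℂ} {G : X → Matrix (Fin l) (Fin p) ℂ}
    (hF : ContinuousOn F s) (hG : ContinuousOn G s) : ContinuousOn (fun t => F t * G t) s :=
  (continuous_fst.matrix_mul continuous_snd).comp_continuousOn (hF.prodMk hG)

theorem ContinuousAt.matrix_inv {X : Type*} [TopologicalSpace X] {x : X}
    {F : X → Matrix (Fin k) (Fin k) ℂ} (hF : ContinuousAt F x) (hx : IsUnit (F x)) :
    ContinuousAt (fun t => (F t)⁻¹) x := by
  have hdet : (F x).det ≠ 0 := ((Matrix.isUnit_iff_isUnit_det _).1 hx).ne_zero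
  refine ContinuousAt.comp (g := Inv.inv) (continuousAt_matrix_inv _ ?_) hF
  rw [Ring.inverse_eq_inv']
  exact continuousAt_inv₀ hdet

theorem ContinuousAt.eventually_isUnit {X : Type*} [TopologicalSpace X] {x : X}
    {F : X → Matrix (Fin k) (Fin k) ℂ} (hF : ContinuousAt F x) (hx : IsUnit (F x)) :
    ∀ᶠ y in nhds x, IsUnit (F y) := by
  have hdet : (F x).det ≠ 0 := ((Matrix.isUnit_iff_isUnit_det _).1 hx).ne_zero
  have hc : ContinuousAt (fun t => (F t).det) x :=
    ContinuousAt.comp (g := Matrix.det) (Continuous.matrix_det continuous_id).continuousAt hF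
  filter_upwards [hc.eventually_ne hdet] with y hy
  exact (Matrix.isUnit_iff_isUnit_det _).2 hy.isUnit

theorem HasDerivAt.matrix_inv {F : ℝ → Matrix (Fin k) (Fin k) ℂ}
    {F' : Matrix (Fin k) (Fin k) ℂ} {x : ℝ} (hF : HasDerivAt F F' x) (hx : IsUnit (F x)) :
    HasDerivAt (fun t => (F t)⁻¹) (-((F x)⁻¹ * F' * (F x)⁻¹)) x := by
  have hslope := hasDerivAt_iff_tendsto_slope.1 hF
  refine hasDerivAt_iff_tendsto_slope.2 ?_
  have hinv : Filter.Tendsto (fun t => (F t)⁻¹) (nhdsWithin x {x}ᶜ) (nhds (F x)⁻¹) :=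
    (hF.continuousAt.matrix_inv hx).tendsto.mono_left nhdsWithin_le_nhds
  have hlim := ((hinv.mul hslope).mul_const (F x)⁻¹).neg
  refine hlim.congr' ?_
  filter_upwards [nhdsWithin_le_nhds (hF.continuousAt.eventually_isUnit hx)] with y hy
  have h1 := Matrix.nonsing_inv_mul _ ((Matrix.isUnit_iff_isUnit_det _).1 hy)
  have h2 := Matrix.mul_nonsing_inv _ ((Matrix.isUnit_iff_isUnit_det _).1 hx)
  have key : (F y)⁻¹ * (F y - F x) * (F x)⁻¹ = -((F y)⁻¹ - (F x)⁻¹) := by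
    rw [mul_sub, h1, sub_mul, mul_assoc, h2, one_mul, mul_one, neg_sub]
  simp only [slope, vsub_eq_sub, Matrix.mul_smul, Matrix.smul_mul, key, smul_neg, neg_neg]

theorem Matrix.norm_mul_le_card (M : Matrix (Fin k) (Fin l) ℂ) (N : Matrix (Fin l) (Fin p) ℂ) :
    ‖M * N‖ ≤ l * ‖M‖ * ‖N‖ := by
  rw [Matrix.norm_le_iff (by positivity)]
  intro i j
  rw [Matrix.mul_apply]
  refine (norm_sum_le_of_le (f := fun r => M i r * N r j) (n := fun _ => ‖M‖ * ‖N‖) _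
    fun r _ => ?_).trans (by simp [mul_assoc])
  rw [norm_mul]
  exact mul_le_mul M.norm_entry_le_entrywise_sup_norm N.norm_entry_le_entrywise_sup_norm
    (norm_nonneg _) (norm_nonneg _)

theorem Matrix.norm_le_exp_of_hasDerivAt {a b K : ℝ} {F F' : ℝ → Matrix (Fin k) (Fin l) ℂ}
    (hF : ∀ x ∈ Set.Icc a b, HasDerivAt F (F' x) x)
    (hK : ∀ x ∈ Set.Icc a b, ‖F' x‖ ≤ K * ‖F x‖) {x : ℝ} (hx : x ∈ Set.Icc a b) :
    ‖F x‖ ≤ ‖F a‖ * Real.exp (K * (x - a)) := by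
  have h := norm_le_gronwallBound_of_norm_deriv_right_le (ε := 0)
    (fun x hx => (hF x hx).continuousAt.continuousWithinAt)
    (fun x hx => (hF x (Set.Ico_subset_Icc_self hx)).hasDerivWithinAt) le_rfl
    (fun x hx => by simpa using hK x (Set.Ico_subset_Icc_self hx)) x hx
  rwa [gronwallBound_ε0] at h

theorem Matrix.eq_of_hasDerivAt_zero {a b : ℝ} {F : ℝ → Matrix (Fin k) (Fin l) ℂ}
    (hF : ∀ x ∈ Set.Icc a b, HasDerivAt F 0 x) {x : ℝ} (hx : x ∈ Set.Icc a b) : F x = F a :=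
  constant_of_has_deriv_right_zero (fun x hx => (hF x hx).continuousAt.continuousWithinAt)
    (fun x hx => (hF x (Set.Ico_subset_Icc_self hx)).hasDerivWithinAt) x hx

theorem Matrix.norm_le_exp_of_linear_ode {a b K : ℝ} {M : ℝ → Matrix (Fin k) (Fin k) ℂ}
    {Y : ℝ → Matrix (Fin k) (Fin l) ℂ} (hM : ∀ x ∈ Set.Icc a b, ‖M x‖ ≤ K)
    (hY : ∀ x ∈ Set.Icc a b, HasDerivAt Y (M x * Y x) x) {x : ℝ} (hx : x ∈ Set.Icc a b) :
    ‖Y x‖ ≤ ‖Y a‖ * Real.exp (k * K * (x - a)) := by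
  refine Matrix.norm_le_exp_of_hasDerivAt hY (fun y hy => ?_) hx
  refine (Matrix.norm_mul_le_card _ _).trans ?_
  gcongr
  exact hM y hy

theorem Matrix.eq_zero_of_linear_ode {a b : ℝ} {M : ℝ → Matrix (Fin k) (Fin k) ℂ}
    {Y : ℝ → Matrix (Fin k) (Fin l) ℂ} (hM : ContinuousOn M (Set.Icc a b))
    (hY : ∀ x ∈ Set.Icc a b, HasDerivAt Y (M x * Y x) x) (ha : Y a = 0) {x : ℝ}
    (hx : x ∈ Set.Icc a b) : Y x = 0 := by
  obtain ⟨K, hK⟩ := isCompact_Icc.exists_bound_of_continuousOn hM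
  simpa [ha] using Matrix.norm_le_exp_of_linear_ode hK hY hx

end Calculus

section Algebra

variable {m n : ℕ}

/-- `I + i J Π* X Π`. -/
noncomputable def gbdtFactor (J : Matrix (Fin m) (Fin m) ℂ) (P : Matrix (Fin n) (Fin m) ℂ)
    (X : Matrix (Fin n) (Fin n) ℂ) : Matrix (Fin m) (Fin m) ℂ :=
  1 + Complex.I • (J * Pᴴ * X * P)

variable {J H : Matrix (Fin m) (Fin m) ℂ} {P : Matrix (Fin n) (Fin m) ℂ}

theorem gbdtFactor_zero : gbdtFactor J P 0 = 1 := by simp [gbdtFactor]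

theorem gbdtFactor_mul (X Y : Matrix (Fin n) (Fin n) ℂ) :
    gbdtFactor J P X * gbdtFactor J P Y =
      gbdtFactor J P (X + Y + X * (Complex.I • (P * J * Pᴴ)) * Y) := by
  simp only [gbdtFactor, Matrix.mul_add, Matrix.add_mul, Matrix.mul_smul, Matrix.smul_mul,
    Matrix.one_mul, Matrix.mul_one, Matrix.mul_assoc]
  module

theorem mul_conjTranspose_gbdtFactor (hJ : Jᴴ = J) (X : Matrix (Fin n) (Fin n) ℂ) :
    J * (gbdtFactor J P X)ᴴ = gbdtFactor J P (-Xᴴ) * J := by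
  simp only [gbdtFactor, Matrix.conjTranspose_add, Matrix.conjTranspose_smul,
    Matrix.conjTranspose_mul, Matrix.conjTranspose_one, Matrix.conjTranspose_conjTranspose, hJ,
    Matrix.mul_add, Matrix.add_mul, Matrix.mul_smul, Matrix.smul_mul, Matrix.mul_neg,
    Matrix.neg_mul, Matrix.one_mul, Matrix.mul_one, Matrix.mul_assoc]
  simp

theorem gbdtFactor_resolvent_mul {B T R R' : Matrix (Fin n) (Fin n) ℂ} {z : ℂ}
    (hT : IsUnit T) (hid : T * Bᴴ - B * T = Complex.I • (P * J * Pᴴ))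
    (hR : R * (z • 1 - B) = 1) (hR' : (z • 1 - Bᴴ) * R' = 1) :
    gbdtFactor J P (-(T⁻¹ * R)) * gbdtFactor J P (R' * T⁻¹) = 1 := by
  have hdet := (Matrix.isUnit_iff_isUnit_det _).1 hT
  have h1 := Matrix.nonsing_inv_mul _ hdet
  have h2 := Matrix.mul_nonsing_inv _ hdet
  have hmid : T⁻¹ * R * (T * Bᴴ - B * T) * (R' * T⁻¹) = R' * T⁻¹ - T⁻¹ * R := by
    have : T * Bᴴ - B * T = (z • 1 - B) * T - T * (z • 1 - Bᴴ) := by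
      simp [sub_mul, mul_sub]
    calc T⁻¹ * R * (T * Bᴴ - B * T) * (R' * T⁻¹)
        = T⁻¹ * (R * (z • 1 - B)) * T * R' * T⁻¹
          - T⁻¹ * R * T * ((z • 1 - Bᴴ) * R') * T⁻¹ := by rw [this]; noncomm_ring
      _ = (T⁻¹ * T) * R' * T⁻¹ - T⁻¹ * R * (T * T⁻¹) := by rw [hR, hR']; noncomm_ring
      _ = R' * T⁻¹ - T⁻¹ * R := by rw [h1, h2]; noncomm_ring
  rw [gbdtFactor_mul, ← hid, neg_mul, neg_mul, hmid]
  convert gbdtFactor_zero using 2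
  abel

theorem gbdtFactor_mul_inv {B T R' A : Matrix (Fin n) (Fin n) ℂ} {z w : ℂ}
    (hT : IsUnit T) (hid : T * Bᴴ - B * T = Complex.I • (P * J * Pᴴ))
    (hR' : R' * (z • 1 - Bᴴ) = 1) (hA : (B - w • 1) * A = 1) :
    gbdtFactor J P (R' * T⁻¹) * gbdtFactor J P (T⁻¹ * A) =
      gbdtFactor J P ((z - w) • (R' * T⁻¹ * A)) := by
  have hdet := (Matrix.isUnit_iff_isUnit_det _).1 hT
  have h1 := Matrix.nonsing_inv_mul _ hdet
  have h2 := Matrix.mul_nonsing_inv _ hdet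
  rw [gbdtFactor_mul, ← hid]
  congr 1
  have hA' : B * A = 1 + w • A := by
    rw [← hA, sub_mul, smul_mul_assoc, one_mul]; abel
  have hR'' : R' * Bᴴ = z • R' - 1 := by
    rw [← hR', mul_sub, mul_smul_comm, mul_one]; abel
  calc R' * T⁻¹ + T⁻¹ * A + R' * T⁻¹ * (T * Bᴴ - B * T) * (T⁻¹ * A)
      = R' * T⁻¹ + T⁻¹ * A + (R' * (T⁻¹ * T) * Bᴴ * T⁻¹ * A
          - R' * T⁻¹ * B * (T * T⁻¹) * A) := by noncomm_ring
    _ = R' * T⁻¹ + T⁻¹ * A + ((R' * Bᴴ) * T⁻¹ * A - R' * T⁻¹ * (B * A)) := by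
        rw [h1, h2]; noncomm_ring
    _ = (z - w) • (R' * T⁻¹ * A) := by
        rw [hA', hR'']
        simp only [sub_mul, mul_add, smul_mul_assoc, mul_smul_comm, mul_one, one_mul, mul_assoc]
        module

theorem smul_resolvent_add {B R' A : Matrix (Fin n) (Fin n) ℂ} {z w : ℂ} (hzw : z - w ≠ 0)
    (hR' : (z • 1 - B) * R' = 1) (hA : A * (B - w • 1) = 1) :
    (z - w)⁻¹ • (R' + A) = A * R' := by
  rw [inv_smul_eq_iff₀ hzw]
  have h1 : z • R' = 1 + B * R' := by
    rw [← hR', sub_mul, smul_mul_assoc, one_mul]; abel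
  have h2 : w • A = A * B - 1 := by
    rw [← hA, mul_sub, mul_smul_comm, mul_one]; abel
  calc R' + A = A * (1 + B * R') - (A * B - 1) * R' := by noncomm_ring
    _ = (z - w) • (A * R') := by
      rw [← h1, ← h2, mul_smul_comm, smul_mul_assoc, sub_smul]

/-- The derivative of the Darboux factor, rewritten in terms of the factor itself. -/
theorem gbdtFactor_deriv_eq (hJ : Jᴴ = J) (hH : Hᴴ = H) {N R' A : Matrix (Fin n) (Fin n) ℂ}
    {ζ : ℂ} (hζ : ζ ≠ 0) (hRA : ζ⁻¹ • (R' + Aᴴ) = Aᴴ * R') :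
    Complex.I • (J * (-(Complex.I • (A * P * J * H)))ᴴ * (R' * N) * P
      + J * Pᴴ * (R' * -(N * (A * P * J * H * J * Pᴴ * Aᴴ) * N)) * P
      + J * Pᴴ * (R' * N) * -(Complex.I • (A * P * J * H))) =
    (Complex.I * ζ⁻¹) • (J * H * gbdtFactor J P (R' * N))
      - (Complex.I * ζ⁻¹) • (gbdtFactor J P (ζ • (R' * N * A)) * (J * H)
        * gbdtFactor J P (-(Aᴴ * N))) := by
  have hkey : J * (H * (J * (Pᴴ * (Aᴴ * (R' * (N * P)))))) =
      ζ⁻¹ • (J * (H * (J * (Pᴴ * (R' * (N * P)))))) +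
      ζ⁻¹ • (J * (H * (J * (Pᴴ * (Aᴴ * (N * P)))))) := by
    rw [← Matrix.mul_assoc Aᴴ, ← hRA]
    simp only [Matrix.mul_add, Matrix.add_mul, Matrix.mul_smul, Matrix.smul_mul, smul_add]
  simp only [gbdtFactor, Matrix.conjTranspose_neg, Matrix.conjTranspose_smul,
    Matrix.conjTranspose_mul, hJ, hH,
    Matrix.mul_add, Matrix.add_mul, Matrix.mul_smul, Matrix.smul_mul, Matrix.mul_neg,
    Matrix.neg_mul, Matrix.one_mul, Matrix.mul_one, Matrix.mul_assoc, hkey]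
  simp only [Complex.star_def, Complex.conj_I]
  match_scalars <;> field_simp <;> simp

end Algebra

section Transform

variable {m n : ℕ}

theorem isUnit_Amat {B : Matrix (Fin n) (Fin n) ℂ} {x : ℝ}
    (hB : IsUnit (B - (x : ℂ) • (1 : Matrix (Fin n) (Fin n) ℂ))) : IsUnit (Amat B x) :=
  (Matrix.isUnit_nonsing_inv_iff).2 hB

theorem mul_Amat {B : Matrix (Fin n) (Fin n) ℂ} {x : ℝ}
    (hB : IsUnit (B - (x : ℂ) • (1 : Matrix (Fin n) (Fin n) ℂ))) :
    (B - (x : ℂ) • 1) * Amat B x = 1 :=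
  Matrix.mul_nonsing_inv _ ((Matrix.isUnit_iff_isUnit_det _).1 hB)

theorem mul_Amat_eq_one_add {B : Matrix (Fin n) (Fin n) ℂ} {x : ℝ}
    (hB : IsUnit (B - (x : ℂ) • (1 : Matrix (Fin n) (Fin n) ℂ))) :
    B * Amat B x = 1 + (x : ℂ) • Amat B x := by
  rw [← mul_Amat hB, sub_mul, smul_mul_assoc, one_mul]; abel

theorem conjTranspose_Amat_mul_eq_one_add {B : Matrix (Fin n) (Fin n) ℂ} {x : ℝ}
    (hB : IsUnit (B - (x : ℂ) • (1 : Matrix (Fin n) (Fin n) ℂ))) :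
    (Amat B x)ᴴ * Bᴴ = 1 + (x : ℂ) • (Amat B x)ᴴ := by
  rw [← Matrix.conjTranspose_mul, mul_Amat_eq_one_add hB]; simp

theorem hasDerivAt_Amat {B : Matrix (Fin n) (Fin n) ℂ} {x : ℝ}
    (hB : IsUnit (B - (x : ℂ) • (1 : Matrix (Fin n) (Fin n) ℂ))) :
    HasDerivAt (Amat B) (Amat B x * Amat B x) x := by
  have h : HasDerivAt (fun t : ℝ => B - (t : ℂ) • (1 : Matrix (Fin n) (Fin n) ℂ)) (-1) x := by
    rw [Matrix.hasDerivAt_iff_entry]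
    intro i j
    simpa using ((Complex.ofRealCLM.hasDerivAt (x := x)).mul_const
      ((1 : Matrix (Fin n) (Fin n) ℂ) i j)).const_sub (B i j)
  exact (h.matrix_inv hB).congr_deriv (by simp [Amat])

theorem continuousOn_Amat {B : Matrix (Fin n) (Fin n) ℂ} {s : Set ℝ}
    (hB : ∀ x ∈ s, IsUnit (B - (x : ℂ) • (1 : Matrix (Fin n) (Fin n) ℂ))) :
    ContinuousOn (Amat B) s :=
  fun x hx => (hasDerivAt_Amat (hB x hx)).continuousAt.continuousWithinAt

/-- `T(x) = A(x) S(x) A(x)*`. -/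
noncomputable def gbdtGram (B : Matrix (Fin n) (Fin n) ℂ) (S : ℝ → Matrix (Fin n) (Fin n) ℂ)
    (x : ℝ) : Matrix (Fin n) (Fin n) ℂ :=
  Amat B x * S x * (Amat B x)ᴴ

theorem isUnit_gbdtGram {B : Matrix (Fin n) (Fin n) ℂ} {S : ℝ → Matrix (Fin n) (Fin n) ℂ} {x : ℝ}
    (hB : IsUnit (B - (x : ℂ) • (1 : Matrix (Fin n) (Fin n) ℂ))) (hS : IsUnit (S x)) :
    IsUnit (gbdtGram B S x) :=
  ((isUnit_Amat hB).mul hS).mul (isUnit_Amat hB).star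

theorem hasDerivAt_gbdtGram {J : Matrix (Fin m) (Fin m) ℂ} {H : ℝ → Matrix (Fin m) (Fin m) ℂ}
    {B : Matrix (Fin n) (Fin n) ℂ} {Φ : ℝ → Matrix (Fin n) (Fin m) ℂ}
    {S : ℝ → Matrix (Fin n) (Fin n) ℂ} {x : ℝ}
    (hB : IsUnit (B - (x : ℂ) • (1 : Matrix (Fin n) (Fin n) ℂ)))
    (hS : HasDerivAt S
      (Φ x * J * H x * Jᴴ * (Φ x)ᴴ - (Amat B x * S x + S x * (Amat B x)ᴴ)) x) :
    HasDerivAt (gbdtGram B S)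
      (Amat B x * Φ x * J * H x * Jᴴ * (Φ x)ᴴ * (Amat B x)ᴴ) x := by
  have hA := hasDerivAt_Amat hB
  refine ((hA.matrix_mul hS).matrix_mul hA.matrix_conjTranspose).congr_deriv ?_
  simp only [Matrix.conjTranspose_mul, Matrix.mul_add, Matrix.add_mul, Matrix.mul_sub,
    Matrix.sub_mul, Matrix.mul_assoc]
  abel

theorem conjTranspose_gbdtGram {a b : ℝ} {J : Matrix (Fin m) (Fin m) ℂ}
    {H : ℝ → Matrix (Fin m) (Fin m) ℂ} (hH : ∀ x ∈ Set.Icc a b, (H x)ᴴ = H x)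
    {B : Matrix (Fin n) (Fin n) ℂ} {Φ : ℝ → Matrix (Fin n) (Fin m) ℂ}
    {S : ℝ → Matrix (Fin n) (Fin n) ℂ}
    (hB : ∀ x ∈ Set.Icc a b, IsUnit (B - (x : ℂ) • (1 : Matrix (Fin n) (Fin n) ℂ)))
    (hS : ∀ x ∈ Set.Icc a b, HasDerivAt S
      (Φ x * J * H x * Jᴴ * (Φ x)ᴴ - (Amat B x * S x + S x * (Amat B x)ᴴ)) x)
    (hSa : S a = (S a)ᴴ) {x : ℝ} (hx : x ∈ Set.Icc a b) :
    (gbdtGram B S x)ᴴ = gbdtGram B S x := by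
  have hconst := Matrix.eq_of_hasDerivAt_zero
    (F := fun t => (gbdtGram B S t)ᴴ - gbdtGram B S t) (a := a) (b := b) (fun t ht => by
      have h := hasDerivAt_gbdtGram (hB t ht) (hS t ht)
      refine (h.matrix_conjTranspose.fun_sub h).congr_deriv ?_
      simp [Matrix.mul_assoc, hH t ht]) hx
  have ha : (gbdtGram B S a)ᴴ = gbdtGram B S a := by
    simp [gbdtGram, Matrix.mul_assoc, ← hSa]
  simp only [ha, sub_self] at hconst
  exact sub_eq_zero.1 hconst

theorem gbdtGram_identity {a b : ℝ} {J : Matrix (Fin m) (Fin m) ℂ} (hJ : Jᴴ = J)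
    {H : ℝ → Matrix (Fin m) (Fin m) ℂ} (hH : ∀ x ∈ Set.Icc a b, (H x)ᴴ = H x)
    {B : Matrix (Fin n) (Fin n) ℂ} {Φ : ℝ → Matrix (Fin n) (Fin m) ℂ}
    {S : ℝ → Matrix (Fin n) (Fin n) ℂ}
    (hB : ∀ x ∈ Set.Icc a b, IsUnit (B - (x : ℂ) • (1 : Matrix (Fin n) (Fin n) ℂ)))
    (hΦ : ∀ x ∈ Set.Icc a b, HasDerivAt Φ (-(Complex.I • (Amat B x * Φ x * J * H x))) x)
    (hS : ∀ x ∈ Set.Icc a b, HasDerivAt S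
      (Φ x * J * H x * Jᴴ * (Φ x)ᴴ - (Amat B x * S x + S x * (Amat B x)ᴴ)) x)
    (hid : Amat B a * S a - S a * (Amat B a)ᴴ = Complex.I • (Φ a * J * (Φ a)ᴴ))
    {x : ℝ} (hx : x ∈ Set.Icc a b) :
    gbdtGram B S x * Bᴴ - B * gbdtGram B S x = Complex.I • (Φ x * J * (Φ x)ᴴ) := by
  have hconst := Matrix.eq_of_hasDerivAt_zero
    (F := fun t => gbdtGram B S t * Bᴴ - B * gbdtGram B S t
      - Complex.I • (Φ t * J * (Φ t)ᴴ)) (a := a) (b := b) (fun t ht => by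
      have h := hasDerivAt_gbdtGram (hB t ht) (hS t ht)
      have hΦt := hΦ t ht
      refine (((h.matrix_mul (hasDerivAt_const t Bᴴ)).fun_sub
        ((hasDerivAt_const t B).matrix_mul h)).fun_sub
        (((hΦt.matrix_mul (hasDerivAt_const t J)).matrix_mul
          hΦt.matrix_conjTranspose).fun_const_smul Complex.I)).congr_deriv ?_
      have hBA := mul_Amat_eq_one_add (hB t ht)
      have hAB := conjTranspose_Amat_mul_eq_one_add (hB t ht)
      have hBA' : B * (Amat B t * (Φ t * (J * (H t * (J * ((Φ t)ᴴ * (Amat B t)ᴴ)))))) =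
          (B * Amat B t) * (Φ t * (J * (H t * (J * ((Φ t)ᴴ * (Amat B t)ᴴ))))) := by
        rw [Matrix.mul_assoc]
      simp only [Matrix.conjTranspose_neg, Matrix.conjTranspose_smul, Matrix.conjTranspose_mul,
        hJ, hH t ht, Matrix.mul_assoc, hBA', hAB, hBA, Matrix.mul_zero, Matrix.zero_mul, add_zero,
        zero_add, Matrix.mul_add, Matrix.add_mul, Matrix.mul_one, Matrix.one_mul,
        Matrix.mul_smul, Matrix.smul_mul, Matrix.mul_neg, Matrix.neg_mul, smul_add, smul_neg,
        smul_smul, Complex.star_def, Complex.conj_I, Complex.I_mul_I, mul_neg]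
      module) hx
  have haI : a ∈ Set.Icc a b := ⟨le_rfl, hx.1.trans hx.2⟩
  have hBa := hB a haI
  have ha : gbdtGram B S a * Bᴴ - B * gbdtGram B S a = Complex.I • (Φ a * J * (Φ a)ᴴ) := by
    rw [← hid, gbdtGram, mul_assoc _ _ Bᴴ, conjTranspose_Amat_mul_eq_one_add hBa,
      ← mul_assoc B, ← mul_assoc B, mul_Amat_eq_one_add hBa]
    simp only [add_mul, mul_add, one_mul, mul_one, smul_mul_assoc, mul_smul_comm, mul_assoc]
    abel
  simp only [ha, sub_self] at hconst
  exact sub_eq_zero.1 hconst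

theorem w0fun_eq_gbdtFactor {J : Matrix (Fin m) (Fin m) ℂ} {B : Matrix (Fin n) (Fin n) ℂ}
    {Φ : ℝ → Matrix (Fin n) (Fin m) ℂ} {S : ℝ → Matrix (Fin n) (Fin n) ℂ} {x : ℝ}
    (hB : IsUnit (B - (x : ℂ) • (1 : Matrix (Fin n) (Fin n) ℂ))) :
    w0fun J B S Φ x = gbdtFactor J (Φ x) (-((Amat B x)ᴴ * (gbdtGram B S x)⁻¹)) := by
  have hA : IsUnit (Amat B x)ᴴ.det := (Matrix.isUnit_iff_isUnit_det _).1 (isUnit_Amat hB).star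
  have : (Amat B x)ᴴ * (gbdtGram B S x)⁻¹ = (S x)⁻¹ * (Amat B x)⁻¹ := by
    rw [gbdtGram, Matrix.mul_inv_rev, ← mul_assoc, Matrix.mul_nonsing_inv _ hA, one_mul,
      Matrix.mul_inv_rev]
  rw [gbdtFactor, this, w0fun]
  simp [Matrix.mul_assoc, sub_eq_add_neg]

theorem HasDerivAt.gbdtFactor {J : Matrix (Fin m) (Fin m) ℂ} {Φ : ℝ → Matrix (Fin n) (Fin m) ℂ}
    {X : ℝ → Matrix (Fin n) (Fin n) ℂ} {Φ' : Matrix (Fin n) (Fin m) ℂ}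
    {X' : Matrix (Fin n) (Fin n) ℂ} {x : ℝ} (hΦ : HasDerivAt Φ Φ' x) (hX : HasDerivAt X X' x) :
    HasDerivAt (fun t => gbdtFactor J (Φ t) (X t))
      (Complex.I • (J * Φ'ᴴ * X x * Φ x + J * (Φ x)ᴴ * X' * Φ x + J * (Φ x)ᴴ * X x * Φ')) x := by
  refine ((((((hasDerivAt_const x J).matrix_mul hΦ.matrix_conjTranspose).matrix_mul hX).matrix_mul
    hΦ).fun_const_smul Complex.I).const_add 1).congr_deriv ?_
  simp only [Matrix.zero_mul, zero_add, Matrix.add_mul]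

theorem continuousOn_gbdtFactor {X : Type*} [TopologicalSpace X] {s : Set X}
    {J : Matrix (Fin m) (Fin m) ℂ} {Φ : X → Matrix (Fin n) (Fin m) ℂ}
    {Y : X → Matrix (Fin n) (Fin n) ℂ} (hΦ : ContinuousOn Φ s) (hY : ContinuousOn Y s) :
    ContinuousOn (fun t => gbdtFactor J (Φ t) (Y t)) s := by
  have hstar : ContinuousOn (fun t => (Φ t)ᴴ) s :=
    (Continuous.matrix_conjTranspose continuous_id).comp_continuousOn hΦ
  exact continuousOn_const.add
    (((((continuousOn_const (c := J)).matrix_mul hstar).matrix_mul hY).matrix_mul hΦ).fun_const_smul _)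

theorem hasDerivAt_gbdtFactor_resolvent {J H : Matrix (Fin m) (Fin m) ℂ} (hJ : Jᴴ = J)
    (hH : Hᴴ = H) {B : Matrix (Fin n) (Fin n) ℂ} {Φ : ℝ → Matrix (Fin n) (Fin m) ℂ}
    {T : ℝ → Matrix (Fin n) (Fin n) ℂ} {x : ℝ} {z : ℂ}
    (hB : IsUnit (B - (x : ℂ) • (1 : Matrix (Fin n) (Fin n) ℂ)))
    (hΦ : HasDerivAt Φ (-(Complex.I • (Amat B x * Φ x * J * H))) x)
    (hT : HasDerivAt T (Amat B x * Φ x * J * H * Jᴴ * (Φ x)ᴴ * (Amat B x)ᴴ) x)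
    (hTu : IsUnit (T x)) (hTh : (T x)ᴴ = T x)
    (hTid : T x * Bᴴ - B * T x = Complex.I • (Φ x * J * (Φ x)ᴴ))
    (hz : z - x ≠ 0) (hzB : IsUnit (z • 1 - Bᴴ)) :
    HasDerivAt (fun t => gbdtFactor J (Φ t) ((z • 1 - Bᴴ)⁻¹ * (T t)⁻¹))
      ((Complex.I * (z - x)⁻¹) • (J * H * gbdtFactor J (Φ x) ((z • 1 - Bᴴ)⁻¹ * (T x)⁻¹))
        - (Complex.I * (z - x)⁻¹) • (gbdtFactor J (Φ x) ((z • 1 - Bᴴ)⁻¹ * (T x)⁻¹) *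
          (J * ((gbdtFactor J (Φ x) (-((Amat B x)ᴴ * (T x)⁻¹)))ᴴ * H *
            gbdtFactor J (Φ x) (-((Amat B x)ᴴ * (T x)⁻¹)))))) x := by
  have hdet := (Matrix.isUnit_iff_isUnit_det _).1 hzB
  have hTinv : HasDerivAt (fun t => (z • 1 - Bᴴ)⁻¹ * (T t)⁻¹) _ x :=
    (hasDerivAt_const x (z • 1 - Bᴴ)⁻¹).matrix_mul (hT.matrix_inv hTu)
  refine (hΦ.gbdtFactor hTinv).congr_deriv ?_
  rw [zero_mul, zero_add, hJ]
  have hA : (Amat B x)ᴴ * (Bᴴ - (x : ℂ) • 1) = 1 := by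
    have := congrArg Matrix.conjTranspose (mul_Amat hB)
    simpa using this
  rw [gbdtFactor_deriv_eq hJ hH hz
    (smul_resolvent_add hz (Matrix.mul_nonsing_inv _ hdet) hA),
    ← gbdtFactor_mul_inv hTu hTid (Matrix.nonsing_inv_mul _ hdet) (mul_Amat hB)]
  have hconj : J * (gbdtFactor J (Φ x) (-((Amat B x)ᴴ * (T x)⁻¹)))ᴴ =
      gbdtFactor J (Φ x) ((T x)⁻¹ * Amat B x) * J := by
    rw [mul_conjTranspose_gbdtFactor hJ]
    simp [Matrix.conjTranspose_nonsing_inv, hTh]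
  simp only [← mul_assoc, hconj]

/-- The transformed fundamental solution in terms of the initial one. -/
theorem transformed_solution_eq {a b : ℝ} {J : Matrix (Fin m) (Fin m) ℂ} (hJ : Jᴴ = J)
    {H : ℝ → Matrix (Fin m) (Fin m) ℂ} (hHc : ContinuousOn H (Set.Icc a b))
    (hH : ∀ x ∈ Set.Icc a b, (H x)ᴴ = H x)
    {B : Matrix (Fin n) (Fin n) ℂ} {Φ : ℝ → Matrix (Fin n) (Fin m) ℂ}
    {T : ℝ → Matrix (Fin n) (Fin n) ℂ}
    (hB : ∀ x ∈ Set.Icc a b, IsUnit (B - (x : ℂ) • (1 : Matrix (Fin n) (Fin n) ℂ)))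
    (hΦ : ∀ x ∈ Set.Icc a b, HasDerivAt Φ (-(Complex.I • (Amat B x * Φ x * J * H x))) x)
    (hT : ∀ x ∈ Set.Icc a b, HasDerivAt T
      (Amat B x * Φ x * J * H x * Jᴴ * (Φ x)ᴴ * (Amat B x)ᴴ) x)
    (hTu : ∀ x ∈ Set.Icc a b, IsUnit (T x)) (hTh : ∀ x ∈ Set.Icc a b, (T x)ᴴ = T x)
    (hTid : ∀ x ∈ Set.Icc a b, T x * Bᴴ - B * T x = Complex.I • (Φ x * J * (Φ x)ᴴ))
    {z : ℂ} (hz : ∀ x ∈ Set.Icc a b, z - (x : ℂ) ≠ 0) (hzB : IsUnit (z • 1 - B))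
    (hzB' : IsUnit (z • 1 - Bᴴ)) {W Wt : ℝ → Matrix (Fin m) (Fin m) ℂ}
    (hWa : W a = 1) (hWta : Wt a = 1)
    (hW : ∀ x ∈ Set.Icc a b, HasDerivAt W
      ((Complex.I * (z - (x : ℂ))⁻¹) • (J * H x * W x)) x)
    (hWt : ∀ x ∈ Set.Icc a b, HasDerivAt Wt ((Complex.I * (z - (x : ℂ))⁻¹) •
      (J * ((gbdtFactor J (Φ x) (-((Amat B x)ᴴ * (T x)⁻¹)))ᴴ * H x *
        gbdtFactor J (Φ x) (-((Amat B x)ᴴ * (T x)⁻¹))) * Wt x)) x)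
    {x : ℝ} (hx : x ∈ Set.Icc a b) :
    Wt x = gbdtFactor J (Φ x) (-((T x)⁻¹ * (z • 1 - B)⁻¹)) * W x *
      gbdtFactor J (Φ a) ((z • 1 - Bᴴ)⁻¹ * (T a)⁻¹) := by
  set P : ℝ → Matrix (Fin m) (Fin m) ℂ :=
    fun t => gbdtFactor J (Φ t) ((z • 1 - Bᴴ)⁻¹ * (T t)⁻¹) with hP
  have hcoeff : ContinuousOn (fun t : ℝ => (Complex.I * (z - (t : ℂ))⁻¹) • (J * H t))
      (Set.Icc a b) := by
    have hscalar : ContinuousOn (fun t : ℝ => Complex.I * (z - (t : ℂ))⁻¹) (Set.Icc a b) :=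
      continuousOn_const.mul (ContinuousOn.inv₀ (by fun_prop) hz)
    exact hscalar.smul ((continuousOn_const (c := J)).matrix_mul hHc)
  have hzero := Matrix.eq_zero_of_linear_ode (Y := fun t => P t * Wt t - W t * P a) hcoeff
    (fun t ht => by
      have hPt := hasDerivAt_gbdtFactor_resolvent hJ (hH t ht) (hB t ht) (hΦ t ht) (hT t ht)
        (hTu t ht) (hTh t ht) (hTid t ht) (hz t ht) hzB'
      refine ((hPt.matrix_mul (hWt t ht)).fun_sub
        ((hW t ht).matrix_mul (hasDerivAt_const t (P a)))).congr_deriv ?_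
      simp only [hP, sub_mul, mul_sub, smul_mul_assoc, mul_smul_comm, mul_assoc, mul_zero,
        add_zero]
      abel) (by simp [hWa, hWta]) hx
  have hdet := (Matrix.isUnit_iff_isUnit_det _).1 hzB
  have hdet' := (Matrix.isUnit_iff_isUnit_det _).1 hzB'
  have hQP := gbdtFactor_resolvent_mul (hTu x hx) (hTid x hx) (Matrix.nonsing_inv_mul _ hdet)
    (Matrix.mul_nonsing_inv _ hdet')
  have hPW : P x * Wt x = W x * P a := sub_eq_zero.1 hzero
  rw [mul_assoc]
  change Wt x = _ * (W x * P a)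
  rw [← hPW, ← mul_assoc, hQP, one_mul]

theorem continuousOn_resolvent {B : Matrix (Fin n) (Fin n) ℂ} {s : Set ℂ}
    (hs : ∀ z ∈ s, IsUnit (z • 1 - B)) : ContinuousOn (fun z : ℂ => (z • 1 - B)⁻¹) s := by
  intro z hz
  have hc : ContinuousAt (fun z : ℂ => z • 1 - B) z := by fun_prop
  exact (hc.matrix_inv (hs z hz)).continuousWithinAt

theorem isOpen_isUnit_smul_one_sub (B : Matrix (Fin n) (Fin n) ℂ) :
    IsOpen {z : ℂ | IsUnit (z • 1 - B)} :=
  isOpen_iff_mem_nhds.2 fun z hz =>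
    ContinuousAt.eventually_isUnit (F := fun z : ℂ => z • 1 - B) (by fun_prop) hz

/-- A compact neighbourhood of the real segment which avoids the spectra of `B` and `B*`. -/
theorem exists_cthickening_isUnit {a b : ℝ} {B : Matrix (Fin n) (Fin n) ℂ}
    (hB : ∀ x ∈ Set.Icc a b, IsUnit (B - (x : ℂ) • (1 : Matrix (Fin n) (Fin n) ℂ))) :
    ∃ δ > 0, ∀ z ∈ Metric.cthickening δ (Complex.ofReal '' Set.Icc a b),
      IsUnit (z • 1 - B) ∧ IsUnit (z • 1 - Bᴴ) := by
  have hcomp : IsCompact (Complex.ofReal '' Set.Icc a b) :=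
    isCompact_Icc.image Complex.continuous_ofReal
  obtain ⟨δ, hδ, hsub⟩ := hcomp.exists_cthickening_subset_open
    ((isOpen_isUnit_smul_one_sub B).inter (isOpen_isUnit_smul_one_sub Bᴴ)) (by
      rintro _ ⟨x, hx, rfl⟩
      have h1 : IsUnit ((x : ℂ) • 1 - B) := by simpa using (hB x hx).neg
      refine ⟨h1, ?_⟩
      have h2 := h1.star
      simpa [Matrix.star_eq_conjTranspose] using h2)
  exact ⟨δ, hδ, hsub⟩

/-- Boundedness of the fundamental solution at the right endpoint transfers to the transformed
system on any set of non-real spectral parameters. -/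
theorem transformed_solution_bounded {a b : ℝ} (hab : a ≤ b) {J : Matrix (Fin m) (Fin m) ℂ}
    (hJ : Jᴴ = J) {H : ℝ → Matrix (Fin m) (Fin m) ℂ} (hHc : ContinuousOn H (Set.Icc a b))
    (hH : ∀ x ∈ Set.Icc a b, (H x)ᴴ = H x)
    {B : Matrix (Fin n) (Fin n) ℂ} {Φ : ℝ → Matrix (Fin n) (Fin m) ℂ}
    {T : ℝ → Matrix (Fin n) (Fin n) ℂ}
    (hB : ∀ x ∈ Set.Icc a b, IsUnit (B - (x : ℂ) • (1 : Matrix (Fin n) (Fin n) ℂ)))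
    (hΦ : ∀ x ∈ Set.Icc a b, HasDerivAt Φ (-(Complex.I • (Amat B x * Φ x * J * H x))) x)
    (hT : ∀ x ∈ Set.Icc a b, HasDerivAt T
      (Amat B x * Φ x * J * H x * Jᴴ * (Φ x)ᴴ * (Amat B x)ᴴ) x)
    (hTu : ∀ x ∈ Set.Icc a b, IsUnit (T x)) (hTh : ∀ x ∈ Set.Icc a b, (T x)ᴴ = T x)
    (hTid : ∀ x ∈ Set.Icc a b, T x * Bᴴ - B * T x = Complex.I • (Φ x * J * (Φ x)ᴴ))
    {W Wt : ℝ → ℂ → Matrix (Fin m) (Fin m) ℂ} {Z : Set ℂ} (hZ : ∀ z ∈ Z, z.im ≠ 0)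
    (hW : ∀ z ∈ Z, W a z = 1 ∧ ∀ x ∈ Set.Icc a b, HasDerivAt (fun t => W t z)
      ((Complex.I * (z - (x : ℂ))⁻¹) • (J * H x * W x z)) x)
    (hWt : ∀ z ∈ Z, Wt a z = 1 ∧ ∀ x ∈ Set.Icc a b, HasDerivAt (fun t => Wt t z)
      ((Complex.I * (z - (x : ℂ))⁻¹) •
        (J * ((gbdtFactor J (Φ x) (-((Amat B x)ᴴ * (T x)⁻¹)))ᴴ * H x *
          gbdtFactor J (Φ x) (-((Amat B x)ᴴ * (T x)⁻¹))) * Wt x z)) x)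
    (hbd : ∃ C : ℝ, ∀ z ∈ Z, ‖W b z‖ ≤ C) : ∃ C : ℝ, ∀ z ∈ Z, ‖Wt b z‖ ≤ C := by
  obtain ⟨C, hC⟩ := hbd
  obtain ⟨δ, hδ, hunit⟩ := exists_cthickening_isUnit hB
  set K := Metric.cthickening δ (Complex.ofReal '' Set.Icc a b)
  have hKc : IsCompact K := (isCompact_Icc.image Complex.continuous_ofReal).cthickening
  have hR := continuousOn_resolvent fun z hz => (hunit z hz).1
  have hR' := continuousOn_resolvent fun z hz => (hunit z hz).2
  obtain ⟨CQ, hCQ⟩ := hKc.exists_bound_of_continuousOn (continuousOn_gbdtFactor (J := J)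
    (continuousOn_const (c := Φ b)) (((continuousOn_const (c := (T b)⁻¹)).matrix_mul hR).neg))
  obtain ⟨CP, hCP⟩ := hKc.exists_bound_of_continuousOn (continuousOn_gbdtFactor (J := J)
    (continuousOn_const (c := Φ a)) (hR'.matrix_mul (continuousOn_const (c := (T a)⁻¹))))
  have hw0 : ContinuousOn (fun t => gbdtFactor J (Φ t) (-((Amat B t)ᴴ * (T t)⁻¹)))
      (Set.Icc a b) := by
    refine continuousOn_gbdtFactor
      (fun x hx => (hΦ x hx).continuousAt.continuousWithinAt) (ContinuousOn.neg ?_)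
    refine ((Continuous.matrix_conjTranspose continuous_id).comp_continuousOn
      (continuousOn_Amat hB)).matrix_mul fun x hx => ?_
    exact ((hT x hx).continuousAt.matrix_inv (hTu x hx)).continuousWithinAt
  obtain ⟨C0, hC0⟩ := isCompact_Icc.exists_bound_of_continuousOn
    ((continuousOn_const (c := J)).matrix_mul
      ((((Continuous.matrix_conjTranspose continuous_id).comp_continuousOn hw0).matrix_mul
        hHc).matrix_mul hw0))
  refine ⟨max (m * (m * CQ * C) * CP)
    (‖(1 : Matrix (Fin m) (Fin m) ℂ)‖ * Real.exp (m * (δ⁻¹ * C0) * (b - a))), fun z hz => ?_⟩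
  have hbI : b ∈ Set.Icc a b := ⟨hab, le_rfl⟩
  by_cases hzK : z ∈ K
  · refine le_max_of_le_left ?_
    have hzx : ∀ x ∈ Set.Icc a b, z - (x : ℂ) ≠ 0 := fun x _ h =>
      hZ z hz (by simpa using congrArg Complex.im h)
    rw [transformed_solution_eq hJ hHc hH hB hΦ hT hTu hTh hTid hzx (hunit z hzK).1
      (hunit z hzK).2 (hW z hz).1 (hWt z hz).1 (hW z hz).2 (hWt z hz).2 hbI]
    have hQ := hCQ z hzK
    have hP := hCP z hzK
    have hCQ0 := (norm_nonneg _).trans hQ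
    have hCnn := (norm_nonneg _).trans (hC z hz)
    refine (Matrix.norm_mul_le_card _ _).trans ?_
    gcongr
    refine (Matrix.norm_mul_le_card _ _).trans ?_
    gcongr
    · exact hQ
    · exact hC z hz
  · refine le_max_of_le_right ?_
    rw [← (hWt z hz).1]
    refine Matrix.norm_le_exp_of_linear_ode (Y := fun t => Wt t z)
      (M := fun x => (Complex.I * (z - (x : ℂ))⁻¹) •
        (J * ((gbdtFactor J (Φ x) (-((Amat B x)ᴴ * (T x)⁻¹)))ᴴ * H x *
          gbdtFactor J (Φ x) (-((Amat B x)ᴴ * (T x)⁻¹))))) (fun x hx => ?_) (fun x hx => ?_) hbI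
    · rw [norm_smul, norm_mul, Complex.norm_I, one_mul, norm_inv]
      have hdist : δ ≤ ‖z - (x : ℂ)‖ := by
        by_contra! h
        exact hzK (Metric.mem_cthickening_of_dist_le z _ δ _ ⟨x, hx, rfl⟩
          (by rw [dist_eq_norm]; exact h.le))
      gcongr
      exact hC0 x hx
    · exact ((hWt z hz).2 x hx).congr_deriv (by rw [smul_mul_assoc])

end Transform

/-- Proposition 3.2: GBDT preserves boundedness of `W(b,z)` in the
open upper (respectively lower) half-plane. -/
theorem stmt_10 {m n : ℕ} (a b : ℝ) (hab : a ≤ b)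
    (J : Matrix (Fin m) (Fin m) ℂ) (hJherm : Jᴴ = J) (hJinv : J * J = 1)
    (H : ℝ → Matrix (Fin m) (Fin m) ℂ) (hHcont : ContinuousOn H (Set.Icc a b))
    (hHpos : ∀ x ∈ Set.Icc a b, (H x).PosSemidef)
    (B : Matrix (Fin n) (Fin n) ℂ)
    (hB : ∀ x ∈ Set.Icc a b,
      IsUnit (B - (x : ℂ) • (1 : Matrix (Fin n) (Fin n) ℂ)))
    (Φ : ℝ → Matrix (Fin n) (Fin m) ℂ) (S : ℝ → Matrix (Fin n) (Fin n) ℂ)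
    (hΦ : ∀ x ∈ Set.Icc a b,
      HasDerivAt Φ (-(Complex.I • (Amat B x * Φ x * J * H x))) x)
    (hS : ∀ x ∈ Set.Icc a b, HasDerivAt S
      (Φ x * J * H x * Jᴴ * (Φ x)ᴴ - (Amat B x * S x + S x * (Amat B x)ᴴ)) x)
    (hSa : S a = (S a)ᴴ)
    (hid : Amat B a * S a - S a * (Amat B a)ᴴ = Complex.I • (Φ a * J * (Φ a)ᴴ))
    (hSinv : ∀ x ∈ Set.Icc a b, IsUnit (S x))
    (W Wt : ℝ → ℂ → Matrix (Fin m) (Fin m) ℂ)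
    (hW : ∀ z : ℂ, z.im ≠ 0 → W a z = 1 ∧
      ∀ x ∈ Set.Icc a b, HasDerivAt (fun t : ℝ => W t z)
        ((Complex.I * (z - (x : ℂ))⁻¹) • (J * H x * W x z)) x)
    (hWt : ∀ z : ℂ, z.im ≠ 0 → Wt a z = 1 ∧
      ∀ x ∈ Set.Icc a b, HasDerivAt (fun t : ℝ => Wt t z)
        ((Complex.I * (z - (x : ℂ))⁻¹) •
          (J * ((w0fun J B S Φ x)ᴴ * H x * w0fun J B S Φ x) * Wt x z)) x) :
    ((∃ C : ℝ, ∀ z : ℂ, 0 < z.im → ‖W b z‖ ≤ C) →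
      ∃ C' : ℝ, ∀ z : ℂ, 0 < z.im → ‖Wt b z‖ ≤ C')
    ∧
    ((∃ C : ℝ, ∀ z : ℂ, z.im < 0 → ‖W b z‖ ≤ C) →
      ∃ C' : ℝ, ∀ z : ℂ, z.im < 0 → ‖Wt b z‖ ≤ C') := by

  have hHh : ∀ x ∈ Set.Icc a b, (H x)ᴴ = H x := fun x hx => (hHpos x hx).isHermitian
  have hWt' : ∀ z : ℂ, z.im ≠ 0 → Wt a z = 1 ∧ ∀ x ∈ Set.Icc a b,
      HasDerivAt (fun t => Wt t z) ((Complex.I * (z - (x : ℂ))⁻¹) •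
        (J * ((gbdtFactor J (Φ x) (-((Amat B x)ᴴ * (gbdtGram B S x)⁻¹)))ᴴ * H x *
          gbdtFactor J (Φ x) (-((Amat B x)ᴴ * (gbdtGram B S x)⁻¹))) * Wt x z)) x := by
    refine fun z hz => ⟨(hWt z hz).1, fun x hx => ?_⟩
    rw [← w0fun_eq_gbdtFactor (hB x hx)]
    exact (hWt z hz).2 x hx
  have key : ∀ Z : Set ℂ, (∀ z ∈ Z, z.im ≠ 0) → (∃ C : ℝ, ∀ z ∈ Z, ‖W b z‖ ≤ C) →
      ∃ C : ℝ, ∀ z ∈ Z, ‖Wt b z‖ ≤ C := fun Z hZ =>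
    transformed_solution_bounded hab hJherm hHcont hHh hB hΦ
      (fun x hx => hasDerivAt_gbdtGram (hB x hx) (hS x hx))
      (fun x hx => isUnit_gbdtGram (hB x hx) (hSinv x hx))
      (fun x hx => conjTranspose_gbdtGram hHh hB hS hSa hx)
      (fun x hx => gbdtGram_identity hJherm hHh hB hΦ hS hid hx) hZ
      (fun z hz => hW z (hZ z hz)) (fun z hz => hWt' z (hZ z hz))
  exact ⟨key {z | 0 < z.im} fun z hz => ne_of_gt hz, key {z | z.im < 0} fun z hz => ne_of_lt hz⟩
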